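/- arXiv:2006.15842 — 2 statements merged into one kernel-verified Lean document; each statement's English description precedes it below -/
import Mathlib

section
/- Let B ≥ 1 be an integer and let θ = [0; B, 1, B, 1, B, 1, ...] be the irrational number with periodic continued fraction alternating B and 1, with convergents p_n/q_n. For each n ≥ 1, set N_n = q_{2n−1} + ⌊(B+2)/2⌋·q_{2n} − 2. Then the largest gap satisfies H(θ, N_n) = ‖q_{2n−1}θ‖ − ⌊(B−2)/2⌋·‖q_{2n}θ‖, and N_n·H(θ, N_n) tends to f(B) as n → ∞. -/
/-- The points `0, {θ}, {2θ}, …, {Nθ}, 1` used in the three-gap theorem. -/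
def gapPoints (θ : ℝ) (N : ℕ) : Set ℝ :=
  insert 1 {x : ℝ | ∃ k : ℕ, k ≤ N ∧ x = Int.fract (k * θ)}

/-- The gap set `G(θ, N)`: the set of differences between consecutive points among
`0, {θ}, {2θ}, …, {Nθ}, 1` sorted in ascending order. -/
def gapSet (θ : ℝ) (N : ℕ) : Set ℝ :=
  {d : ℝ | ∃ a ∈ gapPoints θ N, ∃ b ∈ gapPoints θ N,
    a < b ∧ (∀ c ∈ gapPoints θ N, ¬(a < c ∧ c < b)) ∧ d = b - a}

/-- `H(θ, N)`, the largest gap in the gap set `G(θ, N)`. -/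
noncomputable def maxGap (θ : ℝ) (N : ℕ) : ℝ := sSup (gapSet θ N)

/-- `θ` has all partial quotients `a_i` (for `i ≥ 1`) of its simple continued fraction
expansion bounded by `B`.  (Index `i` of `partDens` corresponds to `a_{i+1}`.) -/
def PartQuotBounded (θ : ℝ) (B : ℕ) : Prop :=
  ∀ i : ℕ, ∀ a ∈ ((GenContFract.of θ).partDens.get? i), a ≤ (B : ℝ)

/-- `S_B`: the set of irrational numbers in `(0,1)` with partial quotients bounded by `B`. -/
def SB (B : ℕ) : Set ℝ :=
  {θ : ℝ | Irrational θ ∧ θ ∈ Set.Ioo (0 : ℝ) 1 ∧ PartQuotBounded θ B}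

/-- `f(B) = sup_{θ ∈ S_B} sup_{N ≥ 1} N · H(θ, N)`. -/
noncomputable def badF (B : ℕ) : ℝ :=
  sSup {x : ℝ | ∃ θ ∈ SB B, ∃ N : ℕ, 1 ≤ N ∧ x = (N : ℝ) * maxGap θ N}

/-- `‖x‖`, the distance from `x` to the nearest integer. -/
noncomputable def distNearestInt (x : ℝ) : ℝ := |x - round x|

lemma fract_mem_gapPoints {θ : ℝ} {N k : ℕ} (hk : k ≤ N) :
    Int.fract (k * θ) ∈ gapPoints θ N :=
  Or.inr ⟨k, hk, rfl⟩

/-- If every index `i ≤ N` has a partner `j ≤ N` such that `jθ` lies, modulo one, at a positive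
distance at most `M` to the right of `iθ`, then no gap exceeds `M`. -/
lemma gap_le_of_exists_successor {θ : ℝ} {N : ℕ} {M : ℝ}
    (h : ∀ i ≤ N, ∃ j ≤ N, ∃ z : ℤ, 0 < j * θ - i * θ - z ∧ j * θ - i * θ - z ≤ M)
    {d : ℝ} (hd : d ∈ gapSet θ N) : d ≤ M := by
  obtain ⟨a, ha, b, hb, hab, hc, rfl⟩ := hd
  have hb1 : b ≤ 1 := by
    rcases hb with rfl | ⟨k, -, rfl⟩
    · exact le_rfl
    · exact (Int.fract_lt_one _).le
  rcases ha with rfl | ⟨i, hi, rfl⟩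
  · linarith
  obtain ⟨j, hj, z, hpos, hle⟩ := h i hi
  rcases lt_or_ge (Int.fract (i * θ) + (j * θ - i * θ - z)) 1 with hlt | hge
  · have hfr : Int.fract (j * θ) = Int.fract (i * θ) + (j * θ - i * θ - z) := by
      rw [Int.fract_eq_iff]
      refine ⟨by linarith [Int.fract_nonneg ((i : ℝ) * θ)], hlt, ⌊(i : ℝ) * θ⌋ + z, ?_⟩
      push_cast
      linarith [Int.floor_add_fract ((i : ℝ) * θ)]
    have := hc _ (fract_mem_gapPoints hj)
    rw [hfr] at this
    by_contra hcon
    exact this ⟨by linarith, by linarith⟩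
  · linarith

/-- Two multiples of `θ` on opposite sides of integers bound the gaps. -/
lemma gap_le_max {θ : ℝ} {N q q' : ℕ} {p p' : ℤ} (hp : 0 < q * θ - p) (hp' : 0 < p' - q' * θ)
    (hN : q + q' ≤ N + 1) {d : ℝ} (hd : d ∈ gapSet θ N) :
    d ≤ max (q * θ - p) (p' - q' * θ) := by
  refine gap_le_of_exists_successor (fun i hi => ?_) hd
  rcases lt_or_ge i q' with h | h
  · refine ⟨i + q, by omega, p, ?_⟩
    have : ((i + q : ℕ) : ℝ) * θ - i * θ - p = q * θ - p := by push_cast; ring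
    rw [this]
    exact ⟨hp, le_max_left _ _⟩
  · refine ⟨i - q', by omega, -p', ?_⟩
    have : ((i - q' : ℕ) : ℝ) * θ - i * θ - (-p' : ℤ) = p' - q' * θ := by
      push_cast [Nat.cast_sub h]; ring
    rw [this]
    exact ⟨hp', le_max_right _ _⟩

/-- No integer combination `lθ - t` with `-(q + q') < l < q` lies strictly between `0` and
`p' - q'θ`, when `(q, p)` and `(q', p')` form a unimodular pair. -/
lemma not_between_of_unimodular {θ : ℝ} {q q' p p' : ℤ} (hdet : p' * q - p * q' = 1)
    (hp : 0 < q * θ - p) (hpp' : q * θ - p ≤ p' - q' * θ) (hq : 0 < q) (hqq' : 0 < q + q')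
    {l t : ℤ} (hl : -(q + q') < l) (hlq : l < q) (h0 : 0 < l * θ - t)
    (h1 : l * θ - t < p' - q' * θ) : False := by
  obtain ⟨x, y, rfl, rfl⟩ : ∃ x y : ℤ, l = x * q + y * q' ∧ t = x * p + y * p' :=
    ⟨p' * l - q' * t, q * t - p * l, by linear_combination -l * hdet,
      by linear_combination -t * hdet⟩
  have hval : ((x * q + y * q' : ℤ) : ℝ) * θ - (x * p + y * p' : ℤ)
      = x * (q * θ - p) - y * (p' - q' * θ) := by push_cast; ring
  rw [hval] at h0 h1
  set δ := (q : ℝ) * θ - p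
  set δ' := (p' : ℝ) - q' * θ
  rcases le_or_gt 0 y with hy | hy
  · have hxy : y + 1 ≤ x := by
      by_contra! hcon
      have h2 : (x : ℝ) ≤ y := by exact_mod_cast (by omega : x ≤ y)
      have h3 : (0 : ℝ) ≤ y := by exact_mod_cast hy
      nlinarith
    nlinarith
  · have h3 : (y : ℝ) + 1 ≤ 0 := by exact_mod_cast (by omega : y + 1 ≤ 0)
    have hxy : x < y + 1 := by
      by_contra! hcon
      have h2 : (y : ℝ) + 1 ≤ x := by exact_mod_cast hcon
      nlinarith
    nlinarith

/-- With `N + 2 = 2q + q'` the points still leave a gap of length `p' - q'θ`. -/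
lemma mem_gapSet_of_unimodular {θ : ℝ} {N : ℕ} {q q' p p' : ℤ} (hdet : p' * q - p * q' = 1)
    (hp : 0 < q * θ - p) (hpp' : q * θ - p ≤ p' - q' * θ) (hq : 0 < q) (hqq' : 0 < q + q')
    (hN : (N : ℤ) + 2 = 2 * q + q') : p' - q' * θ ∈ gapSet θ N := by
  obtain ⟨i, hi⟩ := Int.eq_ofNat_of_zero_le (by omega : 0 ≤ q + q' - 1)
  obtain ⟨j, hj⟩ := Int.eq_ofNat_of_zero_le (by omega : 0 ≤ q - 1)
  have hiN : i ≤ N := by omega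
  have hjN : j ≤ N := by omega
  have hir : (i : ℝ) = q + q' - 1 := by exact_mod_cast hi.symm
  have hjr : (j : ℝ) = q - 1 := by exact_mod_cast hj.symm
  have hfree : ∀ k : ℕ, k ≤ N → ∀ t : ℤ,
      ¬ (0 < (k : ℝ) * θ - i * θ - t ∧ (k : ℝ) * θ - i * θ - t < p' - q' * θ) := by
    rintro k hk t ⟨h0, h1⟩
    have he : (k : ℝ) * θ - i * θ - t = ((k - i : ℤ) : ℝ) * θ - t := by push_cast; ring
    rw [he] at h0 h1
    exact not_between_of_unimodular hdet hp hpp' hq hqq' (by omega) (by omega) h0 h1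
  have hfl := Int.floor_add_fract ((i : ℝ) * θ)
  have hlt1 := Int.fract_lt_one ((i : ℝ) * θ)
  have hle : Int.fract (i * θ) + (p' - q' * θ) ≤ 1 := by
    by_contra! hcon
    refine hfree 0 (Nat.zero_le _) (-⌊(i : ℝ) * θ⌋ - 1) ⟨?_, ?_⟩ <;> push_cast <;> linarith
  refine ⟨Int.fract (i * θ), fract_mem_gapPoints hiN, Int.fract (i * θ) + (p' - q' * θ), ?_,
    by linarith, ?_, by ring⟩
  · rcases hle.lt_or_eq with hlt | heq
    · have hfr : Int.fract (j * θ) = Int.fract (i * θ) + (p' - q' * θ) := by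
        rw [Int.fract_eq_iff]
        refine ⟨by linarith [Int.fract_nonneg ((i : ℝ) * θ)], hlt, ⌊(i : ℝ) * θ⌋ - p', ?_⟩
        push_cast
        rw [hjr]
        rw [hir] at hfl ⊢
        linarith
      rw [← hfr]
      exact fract_mem_gapPoints hjN
    · rw [heq]; exact Set.mem_insert _ _
  · rintro c hc ⟨hc1, hc2⟩
    rcases hc with rfl | ⟨k, hk, rfl⟩
    · linarith
    · have hkfl := Int.floor_add_fract ((k : ℝ) * θ)
      refine hfree k hk (⌊(k : ℝ) * θ⌋ - ⌊(i : ℝ) * θ⌋) ⟨?_, ?_⟩ <;> push_cast <;> linarith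

/-- The iterates of the Gauss map, starting at `θ`. -/
noncomputable def cfTail (θ : ℝ) : ℕ → ℝ
  | 0 => θ
  | k + 1 => Int.fract (cfTail θ k)⁻¹

/-- The partial quotient `a_{k+1}` of `θ ∈ (0,1)`. -/
noncomputable def cfQuot (θ : ℝ) (k : ℕ) : ℕ := ⌊(cfTail θ k)⁻¹⌋₊

/-- The denominators `q_{k-1}` of the convergents with partial quotients `a`. -/
def cfDen (a : ℕ → ℕ) : ℕ → ℕ
  | 0 => 0
  | 1 => 1
  | k + 2 => a k * cfDen a (k + 1) + cfDen a k

/-- The numerators `p_{k-1}` of the convergents with partial quotients `a`. -/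
def cfNum (a : ℕ → ℕ) : ℕ → ℕ
  | 0 => 1
  | 1 => 0
  | k + 2 => a k * cfNum a (k + 1) + cfNum a k

/-- The approximation errors `|q_{k-1} θ - p_{k-1}|`, as products of the tails. -/
noncomputable def cfErr (θ : ℝ) : ℕ → ℝ
  | 0 => 1
  | k + 1 => cfTail θ k * cfErr θ k

section Tails

variable {θ : ℝ}

lemma cfTail_irrational (hθ : Irrational θ) (k : ℕ) : Irrational (cfTail θ k) := by
  induction k with
  | zero => exact hθ
  | succ k ih =>
    have : Irrational ((cfTail θ k)⁻¹ - (⌊(cfTail θ k)⁻¹⌋ : ℤ)) := ih.inv.sub_intCast _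
    exact this

lemma cfTail_mem (hθ : Irrational θ) (h01 : θ ∈ Set.Ioo (0 : ℝ) 1) (k : ℕ) :
    cfTail θ k ∈ Set.Ioo (0 : ℝ) 1 := by
  cases k with
  | zero => exact h01
  | succ k =>
    refine ⟨lt_of_le_of_ne (Int.fract_nonneg _) (cfTail_irrational hθ (k + 1)).ne_zero.symm,
      Int.fract_lt_one _⟩

lemma inv_cfTail (hθ : Irrational θ) (h01 : θ ∈ Set.Ioo (0 : ℝ) 1) (k : ℕ) :
    (cfTail θ k)⁻¹ = cfQuot θ k + cfTail θ (k + 1) := by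
  have h := (cfTail_mem hθ h01 k).1
  have h1 := natCast_floor_eq_intCast_floor (R := ℝ) (inv_nonneg.2 h.le)
  rw [cfQuot, h1, cfTail, Int.floor_add_fract]

lemma cfTail_mul (hθ : Irrational θ) (h01 : θ ∈ Set.Ioo (0 : ℝ) 1) (k : ℕ) :
    cfTail θ k * (cfQuot θ k + cfTail θ (k + 1)) = 1 := by
  rw [← inv_cfTail hθ h01, mul_inv_cancel₀ (cfTail_mem hθ h01 k).1.ne']

lemma one_le_cfQuot (hθ : Irrational θ) (h01 : θ ∈ Set.Ioo (0 : ℝ) 1) (k : ℕ) :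
    1 ≤ cfQuot θ k := by
  have h := cfTail_mem hθ h01 k
  exact Nat.le_floor (by simpa using (one_le_inv₀ h.1).2 h.2.le)

lemma cfErr_pos (hθ : Irrational θ) (h01 : θ ∈ Set.Ioo (0 : ℝ) 1) (k : ℕ) : 0 < cfErr θ k := by
  induction k with
  | zero => exact one_pos
  | succ k ih => exact mul_pos (cfTail_mem hθ h01 k).1 ih

lemma cfErr_rec (hθ : Irrational θ) (h01 : θ ∈ Set.Ioo (0 : ℝ) 1) (k : ℕ) :
    cfErr θ k = cfQuot θ k * cfErr θ (k + 1) + cfErr θ (k + 2) := by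
  simp only [cfErr]
  linear_combination -cfErr θ k * cfTail_mul hθ h01 k

lemma cfDen_mul_sub_cfNum (hθ : Irrational θ) (h01 : θ ∈ Set.Ioo (0 : ℝ) 1) (k : ℕ) :
    (cfDen (cfQuot θ) k : ℝ) * θ - cfNum (cfQuot θ) k = (-1) ^ (k + 1) * cfErr θ k := by
  induction k using Nat.twoStepInduction with
  | zero => simp [cfDen, cfNum, cfErr]
  | one => simp [cfDen, cfNum, cfErr, cfTail]
  | more k ih1 ih2 =>
    simp only [cfDen, cfNum]
    push_cast
    have := cfErr_rec hθ h01 k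
    rw [pow_succ] at ih2 ⊢
    rw [pow_succ]
    linear_combination (cfQuot θ k : ℝ) * ih2 + ih1 + (-1) ^ (k + 1) * this

lemma cfNum_mul_cfDen_sub (a : ℕ → ℕ) (k : ℕ) :
    (cfNum a k : ℤ) * cfDen a (k + 1) - cfNum a (k + 1) * cfDen a k = (-1) ^ k := by
  induction k with
  | zero => simp [cfDen, cfNum]
  | succ k ih =>
    rw [cfDen, cfNum]
    push_cast
    rw [pow_succ]
    linear_combination -ih

lemma cfDen_mul_cfErr_add (hθ : Irrational θ) (h01 : θ ∈ Set.Ioo (0 : ℝ) 1) (k : ℕ) :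
    cfDen (cfQuot θ) (k + 1) * cfErr θ k + cfDen (cfQuot θ) k * cfErr θ (k + 1) = 1 := by
  induction k with
  | zero => simp [cfDen, cfErr]
  | succ k ih =>
    rw [cfErr_rec hθ h01 k] at ih
    rw [cfDen]
    push_cast
    linear_combination ih

lemma cfDen_succ_pos {a : ℕ → ℕ} (ha : ∀ k, 1 ≤ a k) (k : ℕ) : 1 ≤ cfDen a (k + 1) := by
  induction k using Nat.twoStepInduction with
  | zero => simp [cfDen]
  | one => simpa [cfDen] using ha 0
  | more k ih1 ih2 =>
    rw [cfDen]
    nlinarith [ha (k + 1)]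

lemma le_cfDen_succ {a : ℕ → ℕ} (ha : ∀ k, 1 ≤ a k) (k : ℕ) : k ≤ cfDen a (k + 1) := by
  induction k using Nat.twoStepInduction with
  | zero => simp
  | one => simpa [cfDen] using ha 0
  | more k ih1 ih2 =>
    rw [cfDen]
    nlinarith [ha (k + 1), cfDen_succ_pos ha k]

lemma gap_le_cfErr_sub (hθ : Irrational θ) (h01 : θ ∈ Set.Ioo (0 : ℝ) 1) {k r N : ℕ}
    (hr : 1 ≤ r) (hra : r ≤ cfQuot θ k)
    (hN : r * cfDen (cfQuot θ) (k + 1) + cfDen (cfQuot θ) k ≤ N + 1) {d : ℝ}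
    (hd : d ∈ gapSet θ N) : d ≤ cfErr θ k - (r - 1) * cfErr θ (k + 1) := by
  obtain ⟨s, rfl⟩ := Nat.exists_eq_add_of_le' hr
  have h0 := cfDen_mul_sub_cfNum hθ h01 k
  have h1 := cfDen_mul_sub_cfNum hθ h01 (k + 1)
  have hE1 := cfErr_pos hθ h01 (k + 1)
  have hE2 := cfErr_pos hθ h01 (k + 2)
  have hE := cfErr_rec hθ h01 k
  have hra' : ((s : ℝ) + 1) ≤ cfQuot θ k := by exact_mod_cast hra
  have hle : cfErr θ (k + 1) ≤ cfErr θ k - s * cfErr θ (k + 1) := by nlinarith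
  push_cast
  rw [add_sub_cancel_right]
  set Q := cfDen (cfQuot θ)
  set P := cfNum (cfQuot θ)
  rcases Nat.even_or_odd k with hk | hk
  · rw [pow_succ, hk.neg_one_pow] at h0
    rw [pow_succ, pow_succ, hk.neg_one_pow] at h1
    have e1 : (Q (k + 1) : ℝ) * θ - (P (k + 1) : ℤ) = cfErr θ (k + 1) := by
      push_cast; linarith
    have e2 : ((P k + s * P (k + 1) : ℕ) : ℤ) - ((Q k + s * Q (k + 1) : ℕ) : ℝ) * θ
        = cfErr θ k - s * cfErr θ (k + 1) := by
      push_cast; linear_combination -h0 - s * h1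
    have := gap_le_max (by rw [e1]; exact hE1) (by rw [e2]; linarith) (by linarith) hd
    rwa [e1, e2, max_eq_right hle] at this
  · rw [pow_succ, hk.neg_one_pow] at h0
    rw [pow_succ, pow_succ, hk.neg_one_pow] at h1
    have e1 : ((P (k + 1) : ℤ) : ℝ) - (Q (k + 1) : ℝ) * θ = cfErr θ (k + 1) := by
      push_cast; linarith
    have e2 : ((Q k + s * Q (k + 1) : ℕ) : ℝ) * θ - ((P k + s * P (k + 1) : ℕ) : ℤ)
        = cfErr θ k - s * cfErr θ (k + 1) := by
      push_cast; linear_combination h0 + s * h1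
    have := gap_le_max (by rw [e2]; linarith) (by rw [e1]; exact hE1) (by linarith) hd
    rwa [e1, e2, max_eq_left hle] at this

/-- Every `N` lies in a range `r q_k + q_{k-1} ≤ N + 1 < (r + 1) q_k + q_{k-1}`. -/
lemma exists_cfDen_range {a : ℕ → ℕ} (ha : ∀ k, 1 ≤ a k) (N : ℕ) :
    ∃ k r, 1 ≤ r ∧ r ≤ a k ∧ r * cfDen a (k + 1) + cfDen a k ≤ N + 1 ∧
      N + 1 < (r + 1) * cfDen a (k + 1) + cfDen a k := by
  have hex : ∃ k, N + 1 < cfDen a (k + 2) + cfDen a (k + 1) :=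
    ⟨N + 1, by
      have h : N + 2 ≤ cfDen a (N + 1 + 2) := le_cfDen_succ ha (N + 2)
      omega⟩
  set k := Nat.find hex
  have hlt : N + 1 < cfDen a (k + 2) + cfDen a (k + 1) := Nat.find_spec hex
  have hle : cfDen a (k + 1) + cfDen a k ≤ N + 1 := by
    rcases Nat.eq_zero_or_pos k with h | h
    · simp [h, cfDen]
    · have := Nat.find_min hex (m := k - 1) (by omega)
      rw [not_lt, show k - 1 + 2 = k + 1 by omega, show k - 1 + 1 = k by omega] at this
      exact this
  have hq := cfDen_succ_pos ha k
  have hlo := Nat.div_mul_le_self (N + 1 - cfDen a k) (cfDen a (k + 1))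
  have hup := Nat.lt_div_mul_add hq (a := N + 1 - cfDen a k)
  refine ⟨k, (N + 1 - cfDen a k) / cfDen a (k + 1), ?_, ?_, by omega, ?_⟩
  · rw [Nat.one_le_div_iff hq]; omega
  · rw [← Nat.lt_succ_iff, Nat.div_lt_iff_lt_mul hq]
    rw [cfDen] at hlt
    rw [Nat.succ_mul]; omega
  · rw [Nat.succ_mul]; omega

end Tails

section Translation

lemma cfTail_succ_eq (θ : ℝ) (k : ℕ) : cfTail θ (k + 1) = cfTail (Int.fract θ⁻¹) k := by
  induction k with
  | zero => rfl
  | succ k ih => rw [cfTail, ih, cfTail]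

lemma of_s_get?_eq {v : ℝ} (hv : Irrational v) (k : ℕ) :
    (GenContFract.of v).s.get? k = some ⟨1, (cfQuot (Int.fract v) k : ℝ)⟩ := by
  have hfr : ∀ {w : ℝ}, Irrational w → Irrational (Int.fract w) := fun {w} hw =>
    hw.sub_intCast ⌊w⌋
  induction k generalizing v with
  | zero =>
    have h := GenContFract.of_s_head (v := v) (hfr hv).ne_zero
    change (GenContFract.of v).s.get? 0 = _ at h
    rw [h, cfQuot, cfTail, natCast_floor_eq_intCast_floor (inv_nonneg.2 (Int.fract_nonneg v))]
  | succ k ih =>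
    rw [GenContFract.of_s_succ, ih (hfr hv).inv, cfQuot, cfQuot, cfTail_succ_eq]

variable {θ : ℝ}

lemma of_s_get?_eq_of_mem (hθ : Irrational θ) (h01 : θ ∈ Set.Ioo (0 : ℝ) 1) (k : ℕ) :
    (GenContFract.of θ).s.get? k = some ⟨1, (cfQuot θ k : ℝ)⟩ := by
  rw [of_s_get?_eq hθ, Int.fract_eq_self.2 ⟨h01.1.le, h01.2⟩]

lemma partDens_get?_eq (hθ : Irrational θ) (h01 : θ ∈ Set.Ioo (0 : ℝ) 1) (k : ℕ) :
    (GenContFract.of θ).partDens.get? k = some (cfQuot θ k : ℝ) :=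
  GenContFract.partDen_eq_s_b (of_s_get?_eq_of_mem hθ h01 k)

lemma dens_eq_cfDen (hθ : Irrational θ) (h01 : θ ∈ Set.Ioo (0 : ℝ) 1) (k : ℕ) :
    (GenContFract.of θ).dens k = cfDen (cfQuot θ) (k + 1) := by
  induction k using Nat.twoStepInduction with
  | zero => simp [cfDen]
  | one => simp [GenContFract.first_den_eq (of_s_get?_eq_of_mem hθ h01 0), cfDen]
  | more k ih1 ih2 =>
    rw [GenContFract.dens_recurrence (of_s_get?_eq_of_mem hθ h01 (k + 1)) ih1 ih2,
      show cfDen (cfQuot θ) (k + 2 + 1) = cfQuot θ (k + 1) * cfDen (cfQuot θ) (k + 1 + 1) +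
        cfDen (cfQuot θ) (k + 1) from rfl]
    push_cast
    ring

lemma distNearestInt_eq {x δ : ℝ} (z : ℤ) (h : |x - z| = δ) (hδ : δ < 1 / 2) :
    distNearestInt x = δ := by
  have hz : round x = z := by
    have := abs_lt.1 (h ▸ hδ)
    rw [round_eq_iff]
    exact ⟨by linarith, by linarith⟩
  rw [distNearestInt, hz, h]

lemma cfErr_lt_half (hθ : Irrational θ) (h01 : θ ∈ Set.Ioo (0 : ℝ) 1) (k : ℕ) :
    cfErr θ (k + 2) < 1 / 2 := by
  induction k with
  | zero =>
    have h := cfErr_rec hθ h01 0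
    have hlt : cfErr θ 2 < cfErr θ 1 := by
      have := (cfTail_mem hθ h01 1).2
      have := cfErr_pos hθ h01 1
      rw [cfErr]; nlinarith
    have h1 : (1 : ℝ) ≤ cfQuot θ 0 := by exact_mod_cast one_le_cfQuot hθ h01 0
    have h0 : cfErr θ 0 = 1 := rfl
    have := cfErr_pos hθ h01 1
    simp only [zero_add] at h ⊢
    nlinarith
  | succ k ih =>
    have := (cfTail_mem hθ h01 (k + 2)).2
    have := cfErr_pos hθ h01 (k + 2)
    rw [cfErr]; nlinarith

lemma distNearestInt_dens (hθ : Irrational θ) (h01 : θ ∈ Set.Ioo (0 : ℝ) 1) (k : ℕ) :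
    distNearestInt ((GenContFract.of θ).dens (k + 1) * θ) = cfErr θ (k + 2) := by
  refine distNearestInt_eq (cfNum (cfQuot θ) (k + 2)) ?_ (cfErr_lt_half hθ h01 k)
  rw [dens_eq_cfDen hθ h01]
  push_cast
  rw [cfDen_mul_sub_cfNum hθ h01, abs_mul, abs_neg_one_pow, one_mul,
    abs_of_pos (cfErr_pos hθ h01 _)]

end Translation

section Extremal

variable {θ ξ : ℝ} {B : ℕ}

lemma cfTail_le (hθ : Irrational θ) (h01 : θ ∈ Set.Ioo (0 : ℝ) 1) (hB : ∀ k, cfQuot θ k ≤ B)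
    (hξ0 : 0 < ξ) (hξ : ξ ^ 2 + B * ξ = B) (k : ℕ) : cfTail θ k ≤ ξ := by
  have hbdd : BddAbove (Set.range (cfTail θ)) :=
    ⟨1, by rintro _ ⟨k, rfl⟩; exact (cfTail_mem hθ h01 k).2.le⟩
  set M := ⨆ k, cfTail θ k
  have hle : ∀ k, cfTail θ k ≤ M := le_ciSup hbdd
  have hM0 : 0 < M := (cfTail_mem hθ h01 0).1.trans_le (hle 0)
  have hB0 : (0 : ℝ) ≤ B := Nat.cast_nonneg B
  have hstep : M ≤ (B + M) / (B + M + 1) := by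
    refine ciSup_le fun k => ?_
    rw [le_div_iff₀ (by positivity)]
    have h0 := (cfTail_mem hθ h01 k).1
    have h1 := (cfTail_mem hθ h01 (k + 1)).1
    have e0 := cfTail_mul hθ h01 k
    have e1 := cfTail_mul hθ h01 (k + 1)
    have hq0 : (1 : ℝ) ≤ cfQuot θ k := by exact_mod_cast one_le_cfQuot hθ h01 k
    have hq1 : (cfQuot θ (k + 1) : ℝ) ≤ B := by exact_mod_cast hB (k + 1)
    have f0 : cfTail θ k * (1 + cfTail θ (k + 1)) ≤ 1 := by
      exact (mul_le_mul_of_nonneg_left (by linarith) h0.le).trans_eq e0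
    have f1 : 1 ≤ cfTail θ (k + 1) * (B + M) := by
      rw [← e1]; gcongr; exact hle _
    have f2 := mul_le_mul_of_nonneg_left f1 h0.le
    have f3 := mul_le_mul_of_nonneg_right f0 (by positivity : 0 ≤ B + M)
    nlinarith
  rw [le_div_iff₀ (by positivity)] at hstep
  refine (hle k).trans ?_
  by_contra! hcon
  nlinarith

lemma le_cfTail_odd (hθ : Irrational θ) (h01 : θ ∈ Set.Ioo (0 : ℝ) 1)
    (hq : ∀ k, cfQuot θ k = if k % 2 = 0 then B else 1)
    (hξ0 : 0 < ξ) (hξ : ξ ^ 2 + B * ξ = B) (n : ℕ) : ξ ≤ cfTail θ (2 * n + 1) := by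
  have hbdd : BddBelow (Set.range fun n => cfTail θ (2 * n + 1)) :=
    ⟨0, by rintro _ ⟨k, rfl⟩; exact (cfTail_mem hθ h01 _).1.le⟩
  set M := ⨅ n, cfTail θ (2 * n + 1)
  have hle : ∀ n, M ≤ cfTail θ (2 * n + 1) := ciInf_le hbdd
  have hM0 : 0 ≤ M := le_ciInf fun n => (cfTail_mem hθ h01 _).1.le
  have hB0 : (0 : ℝ) ≤ B := Nat.cast_nonneg B
  have hstep : (B + M) / (B + M + 1) ≤ M := by
    refine le_ciInf fun n => ?_
    rw [div_le_iff₀ (by positivity)]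
    have h0 := (cfTail_mem hθ h01 (2 * n + 1)).1
    have h1 := (cfTail_mem hθ h01 (2 * n + 1 + 1)).1
    have e0 := cfTail_mul hθ h01 (2 * n + 1)
    have e1 := cfTail_mul hθ h01 (2 * n + 1 + 1)
    rw [hq, if_neg (by omega), Nat.cast_one] at e0
    rw [hq, if_pos (by omega)] at e1
    have f1 : cfTail θ (2 * n + 1 + 1) * (B + M) ≤ 1 := by
      rw [← e1]; gcongr; exact hle (n + 1)
    have f2 := mul_le_mul_of_nonneg_left f1 h0.le
    nlinarith
  rw [div_le_iff₀ (by positivity)] at hstep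
  refine le_trans ?_ (hle n)
  by_contra! hcon
  nlinarith

lemma lt_one_of_sq_add (hξ0 : 0 < ξ) (hξ : ξ ^ 2 + B * ξ = B) : ξ < 1 := by
  have hB0 : (0 : ℝ) ≤ B := Nat.cast_nonneg B
  by_contra! hcon
  nlinarith

lemma cfDen_bounds {a : ℕ → ℕ} (ha : ∀ k, 1 ≤ a k) (haB : ∀ k, a k ≤ B) (hB : 1 ≤ B)
    (hξ0 : 0 < ξ) (hξ : ξ ^ 2 + B * ξ = B) (k : ℕ) :
    (cfDen a k : ℝ) - 1 ≤ ξ * cfDen a (k + 1) ∧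
      ξ * cfDen a (k + 1) ≤ B * (cfDen a k + 1) := by
  have hξ1 := lt_one_of_sq_add hξ0 hξ
  have hB1 : (1 : ℝ) ≤ B := by exact_mod_cast hB
  induction k with
  | zero => simp only [cfDen]; constructor <;> norm_num <;> linarith
  | succ k ih =>
    obtain ⟨ih1, ih2⟩ := ih
    have h1 : (1 : ℝ) ≤ a k := by exact_mod_cast ha k
    have h2 : (a k : ℝ) ≤ B := by exact_mod_cast haB k
    have hQ0 : (0 : ℝ) ≤ cfDen a k := Nat.cast_nonneg _
    have hQ : (0 : ℝ) ≤ cfDen a (k + 1) := Nat.cast_nonneg _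
    rw [cfDen]
    push_cast
    set Q := (cfDen a (k + 1) : ℝ)
    set Q' := (cfDen a k : ℝ)
    have hl : ξ * (Q + Q') ≤ ξ * (a k * Q + Q') := by gcongr; nlinarith
    have hu : ξ * (a k * Q + Q') ≤ ξ * (B * Q + Q') := by gcongr
    constructor
    · have h3 : ξ * (ξ * Q) ≤ ξ * (B * (Q' + 1)) := by gcongr
      have h4 : B * (Q - ξ) ≤ B * (ξ * (Q + Q')) := by
        have : ξ ^ 2 * Q + B * ξ * Q = B * Q := by rw [← add_mul, hξ]
        nlinarith
      have := le_of_mul_le_mul_left h4 (by linarith)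
      linarith
    · have h3 : ξ * Q' ≤ ξ * (ξ * Q + 1) := by gcongr; linarith
      have : ξ ^ 2 * Q + B * ξ * Q = B * Q := by rw [← add_mul, hξ]
      nlinarith

/-- The candidate for `f(B)`, in terms of `ξ = [0; 1, B, 1, B, …]`. -/
noncomputable def extremalValue (B : ℕ) (ξ : ℝ) : ℝ :=
  (((B / 2 + 1 : ℕ) : ℝ) + ξ) * (B + 2 - ((B / 2 + 1 : ℕ) : ℝ) + ξ) / (B + 2 * ξ)

lemma mul_le_balanced (B j : ℕ) :
    (j : ℝ) * (B + 2 - j) ≤ ((B / 2 + 1 : ℕ) : ℝ) * (B + 2 - ((B / 2 + 1 : ℕ) : ℝ)) := by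
  have h : (0 : ℤ) ≤ (((B / 2 + 1 : ℕ) : ℤ) - j) * (B + 2 - ((B / 2 + 1 : ℕ) : ℤ) - j) := by
    rcases le_or_gt j (B / 2 + 1) with h | h
    · rcases h.lt_or_eq with h | h
      · exact mul_nonneg (by omega) (by omega)
      · rw [h]; simp
    · exact mul_nonneg_of_nonpos_of_nonpos (by omega) (by omega)
  have h' : (0 : ℝ) ≤ (((B / 2 + 1 : ℕ) : ℝ) - j) * (B + 2 - ((B / 2 + 1 : ℕ) : ℝ) - j) := by
    exact_mod_cast h
  linarith

lemma extremalValue_pos (hξ0 : 0 < ξ) : 0 < extremalValue B ξ := by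
  have h : ((B / 2 + 1 : ℕ) : ℝ) ≤ B + 2 := by exact_mod_cast (by omega : B / 2 + 1 ≤ B + 2)
  have : 0 < (B : ℝ) + 2 - ((B / 2 + 1 : ℕ) : ℝ) + ξ := by linarith
  unfold extremalValue
  positivity

lemma two_le_extremalValue (hB : 2 ≤ B) (hξ0 : 0 < ξ) : 2 ≤ extremalValue B ξ := by
  have h1 : (2 : ℝ) ≤ ((B / 2 + 1 : ℕ) : ℝ) := by exact_mod_cast (by omega : 2 ≤ B / 2 + 1)
  have h2 : ((B / 2 + 1 : ℕ) : ℝ) ≤ B := by exact_mod_cast (by omega : B / 2 + 1 ≤ B)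
  rw [extremalValue, le_div_iff₀ (by positivity)]
  nlinarith

/-- The bound in normalised form, away from the last intermediate range. -/
lemma mul_le_extremalValue_mul {r a : ℕ} {x β : ℝ} (hr : 1 ≤ r) (hra : r < a) (haB : a ≤ B)
    (hξ0 : 0 < ξ) (hx0 : 0 ≤ x) (hx : x ≤ ξ) (hβ0 : 0 < β) (hβ : β ≤ ξ) :
    (r + 1 + x) * (a - r + 1 + β) ≤ extremalValue B ξ * (a + β + x) := by
  have hr' : (1 : ℝ) ≤ r := by exact_mod_cast hr
  have hra' : (r : ℝ) + 1 ≤ a := by exact_mod_cast hra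
  have haB' : (a : ℝ) ≤ B := by exact_mod_cast haB
  have hbal := mul_le_balanced B (r + 1)
  rw [extremalValue, div_mul_eq_mul_div, le_div_iff₀ (by positivity)]
  set m := ((B / 2 + 1 : ℕ) : ℝ)
  push_cast at hbal
  have h1 : ((r : ℝ) + 1 + ξ) * (B - r + 1 + ξ) ≤ (m + ξ) * (B + 2 - m + ξ) := by nlinarith
  refine le_trans ?_ (mul_le_mul_of_nonneg_right h1 (by linarith))
  obtain ⟨s, hs⟩ : ∃ s, s = r - 1 + x := ⟨_, rfl⟩
  obtain ⟨w, hw⟩ : ∃ w, w = a - r - 1 + β := ⟨_, rfl⟩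
  obtain ⟨S, hS⟩ : ∃ S, S = r - 1 + ξ := ⟨_, rfl⟩
  obtain ⟨W, hW⟩ : ∃ W, W = B - r - 1 + ξ := ⟨_, rfl⟩
  have hs0 : 0 ≤ s := by linarith
  have hw0 : 0 ≤ w := by linarith
  have hsS : s ≤ S := by linarith
  have hwW : w ≤ W := by linarith
  have g1 : s * w * S ≤ S * W * s := by
    have := mul_le_mul_of_nonneg_left hwW (mul_nonneg hs0 (hs0.trans hsS)); linarith
  have g2 : s * w * W ≤ S * W * w := by
    have := mul_le_mul_of_nonneg_left hsS (mul_nonneg hw0 (hw0.trans hwW)); linarith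
  have g3 : s * w ≤ S * W := mul_le_mul hsS hwW hw0 (hs0.trans hsS)
  have key : (s + 2) * (w + 2) * (S + W + 2) ≤ (S + 2) * (W + 2) * (s + w + 2) := by linarith
  rw [hs, hw, hS, hW] at key
  linarith

lemma le_extremalValue_mul {r a : ℕ} {q p β X : ℝ} (hB : 1 ≤ B) (hr : 1 ≤ r) (hra : r ≤ a)
    (haB : a ≤ B) (hξ0 : 0 < ξ) (hξ : ξ ^ 2 + B * ξ = B) (hq : 0 < q) (hp : 0 ≤ p)
    (hpq : p - 1 ≤ ξ * q) (hqp : ξ * q ≤ B * (p + 1)) (hβ0 : 0 < β) (hβ : β ≤ ξ)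
    (hX : X ≤ (r + 1) * q + p - 2) :
    X * (a - r + 1 + β) ≤ extremalValue B ξ * (q * (a + β) + p) := by
  have hL := extremalValue_pos (B := B) hξ0
  have hξ1 := lt_one_of_sq_add hξ0 hξ
  have hra' : (r : ℝ) ≤ a := by exact_mod_cast hra
  have hr' : (1 : ℝ) ≤ r := by exact_mod_cast hr
  have hv : 0 < (a : ℝ) - r + 1 + β := by linarith
  rcases hB.eq_or_lt with rfl | hB2
  · obtain rfl : r = 1 := by omega
    obtain rfl : a = 1 := by omega
    rw [extremalValue, div_mul_eq_mul_div, le_div_iff₀ (by positivity)]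
    norm_num at hX hqp hξ ⊢
    have h1 : X * (1 + β) ≤ (2 * q + p - 2) * (1 + β) := by gcongr
    have h2 : (2 * q + p - 2) * (1 + 2 * ξ) ≤ (2 + ξ) * (q * (1 + ξ) + p) := by nlinarith
    have h3 : (1 + β) * (q * (1 + ξ) + p) ≤ (1 + ξ) * (q * (1 + β) + p) := by nlinarith
    calc X * (1 + β) * (1 + 2 * ξ) ≤ (2 * q + p - 2) * (1 + β) * (1 + 2 * ξ) := by gcongr
      _ = (2 * q + p - 2) * (1 + 2 * ξ) * (1 + β) := by ring
      _ ≤ (2 + ξ) * (q * (1 + ξ) + p) * (1 + β) := by gcongr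
      _ = (2 + ξ) * ((1 + β) * (q * (1 + ξ) + p)) := by ring
      _ ≤ (2 + ξ) * ((1 + ξ) * (q * (1 + β) + p)) := by gcongr
      _ = _ := by ring
  obtain ⟨x, hx0, hxξ, hxp, hpx⟩ : ∃ x, 0 ≤ x ∧ x ≤ ξ ∧ q * x ≤ p ∧ p - 2 ≤ q * x := by
    rcases le_total p (ξ * q) with h | h
    · refine ⟨p / q, by positivity, (div_le_iff₀ hq).2 h, ?_, ?_⟩
      · rw [mul_div_cancel₀ _ hq.ne']
      · rw [mul_div_cancel₀ _ hq.ne']; linarith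
    · exact ⟨ξ, hξ0.le, le_rfl, by linarith, by linarith⟩
  have hcore : (r + 1 + x) * (a - r + 1 + β) ≤ extremalValue B ξ * (a + β + x) := by
    rcases hra.lt_or_eq with h | rfl
    · exact mul_le_extremalValue_mul hr h haB hξ0 hx0 hxξ hβ0 hβ
    · have h2 := two_le_extremalValue hB2 hξ0
      have h3 : (r + 1 + x) * ((r : ℝ) - r + 1 + β) ≤ 2 * (r + β + x) := by nlinarith
      exact h3.trans (by gcongr)
  calc X * (a - r + 1 + β) ≤ q * (r + 1 + x) * (a - r + 1 + β) := by gcongr; linarith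
    _ = q * ((r + 1 + x) * (a - r + 1 + β)) := by ring
    _ ≤ q * (extremalValue B ξ * (a + β + x)) := by gcongr
    _ = extremalValue B ξ * (q * (a + β) + q * x) := by ring
    _ ≤ _ := by gcongr

lemma mul_maxGap_le (hB1 : 1 ≤ B) (hθ : Irrational θ) (h01 : θ ∈ Set.Ioo (0 : ℝ) 1)
    (hB : ∀ k, cfQuot θ k ≤ B) (hξ0 : 0 < ξ) (hξ : ξ ^ 2 + B * ξ = B) (N : ℕ) :
    (N : ℝ) * maxGap θ N ≤ extremalValue B ξ := by
  have ha := one_le_cfQuot hθ h01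
  obtain ⟨k, r, hr, hra, hlo, hup⟩ := exists_cfDen_range ha N
  have hE1 := cfErr_pos hθ h01 (k + 1)
  have hrec : cfErr θ k = (cfQuot θ k + cfTail θ (k + 1)) * cfErr θ (k + 1) := by
    rw [cfErr_rec hθ h01 k, show cfErr θ (k + 2) = cfTail θ (k + 1) * cfErr θ (k + 1) from rfl]
    ring
  have hβ := cfTail_mem hθ h01 (k + 1)
  have hra' : (r : ℝ) ≤ cfQuot θ k := by exact_mod_cast hra
  have hgap : maxGap θ N ≤ (cfQuot θ k - r + 1 + cfTail θ (k + 1)) * cfErr θ (k + 1) := by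
    refine Real.sSup_le (fun d hd => ?_) (mul_nonneg (by linarith [hβ.1]) hE1.le)
    have := gap_le_cfErr_sub hθ h01 hr hra hlo hd
    rw [hrec] at this
    linarith
  have hone := cfDen_mul_cfErr_add hθ h01 k
  obtain ⟨hb1, hb2⟩ := cfDen_bounds ha hB hB1 hξ0 hξ k
  have hup' : (N : ℝ) + 2 ≤ (r + 1) * cfDen (cfQuot θ) (k + 1) + cfDen (cfQuot θ) k := by
    exact_mod_cast hup
  have hQ : (0 : ℝ) < cfDen (cfQuot θ) (k + 1) := by exact_mod_cast cfDen_succ_pos ha k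
  have key := le_extremalValue_mul (X := N) hB1 hr hra (hB k) hξ0 hξ hQ (Nat.cast_nonneg _) hb1
    hb2 hβ.1 (cfTail_le hθ h01 hB hξ0 hξ (k + 1)) (by linarith)
  calc (N : ℝ) * maxGap θ N
      ≤ N * ((cfQuot θ k - r + 1 + cfTail θ (k + 1)) * cfErr θ (k + 1)) := by gcongr
    _ = N * (cfQuot θ k - r + 1 + cfTail θ (k + 1)) * cfErr θ (k + 1) := by ring
    _ ≤ _ := mul_le_mul_of_nonneg_right key hE1.le
    _ = extremalValue B ξ := by rw [hrec] at hone; linear_combination extremalValue B ξ * hone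

end Extremal

section Periodic

variable {θ ξ : ℝ} {B : ℕ}

lemma floor_add_two_half (B : ℕ) : ⌊((B : ℝ) + 2) / 2⌋ = ((B / 2 + 1 : ℕ) : ℤ) := by
  have h1 : 2 * ((B / 2 : ℕ) : ℝ) ≤ B := by exact_mod_cast Nat.mul_div_le B 2
  have h2 : (B : ℝ) < 2 * ((B / 2 : ℕ) : ℝ) + 2 := by exact_mod_cast (by omega)
  rw [Int.floor_eq_iff, Int.cast_natCast, Nat.cast_add_one]
  constructor <;> linarith

lemma floor_sub_two_half (B : ℕ) : ⌊((B : ℝ) - 2) / 2⌋ = ((B / 2 : ℕ) : ℤ) - 1 := by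
  have h := floor_add_two_half B
  rw [show ((B : ℝ) + 2) / 2 = ((B : ℝ) - 2) / 2 + (2 : ℤ) by push_cast; ring,
    Int.floor_add_intCast] at h
  omega

lemma exists_pos_sq_add (B : ℕ) (hB : 1 ≤ B) : ∃ ξ : ℝ, 0 < ξ ∧ ξ ^ 2 + B * ξ = B := by
  have hB1 : (1 : ℝ) ≤ B := by exact_mod_cast hB
  have hsq := Real.sq_sqrt (by positivity : (0 : ℝ) ≤ B ^ 2 + 4 * B)
  refine ⟨(-B + √(B ^ 2 + 4 * B)) / 2, ?_, by linear_combination hsq / 4⟩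
  have : (B : ℝ) < √(B ^ 2 + 4 * B) := Real.lt_sqrt_of_sq_lt (by linarith)
  linarith

lemma maxGap_eq (hθ : Irrational θ) (h01 : θ ∈ Set.Ioo (0 : ℝ) 1) (hB : 1 ≤ B)
    (hq : ∀ k, cfQuot θ k = if k % 2 = 0 then B else 1) {n N : ℕ} (hn : 1 ≤ n)
    (hN : N + 2 = cfDen (cfQuot θ) (2 * n) + (B / 2 + 1) * cfDen (cfQuot θ) (2 * n + 1)) :
    maxGap θ N = cfErr θ (2 * n) - (((B / 2 : ℕ) : ℝ) - 1) * cfErr θ (2 * n + 1) := by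
  have ha := one_le_cfQuot hθ h01
  have hQ1 := cfDen_succ_pos ha (2 * n)
  have hQ0 := cfDen_succ_pos ha (2 * n - 1)
  rw [show 2 * n - 1 + 1 = 2 * n by omega] at hQ0
  have hE1 := cfErr_pos hθ h01 (2 * n + 1)
  have hE2 := cfErr_pos hθ h01 (2 * n + 2)
  refine IsGreatest.csSup_eq ⟨?_, fun d hd => ?_⟩
  · have h0 := cfDen_mul_sub_cfNum hθ h01 (2 * n)
    have h1 := cfDen_mul_sub_cfNum hθ h01 (2 * n + 1)
    have hdet := cfNum_mul_cfDen_sub (cfQuot θ) (2 * n)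
    have hrec := cfErr_rec hθ h01 (2 * n)
    rw [hq, if_pos (by omega)] at hrec
    rw [pow_succ, (even_two_mul n).neg_one_pow] at h0
    rw [pow_succ, pow_succ, (even_two_mul n).neg_one_pow] at h1
    rw [(even_two_mul n).neg_one_pow] at hdet
    have hBle : ((B / 2 : ℕ) : ℝ) ≤ B := by exact_mod_cast Nat.div_le_self B 2
    set Q := cfDen (cfQuot θ)
    set P := cfNum (cfQuot θ)
    set b := B / 2
    have e1 : ((Q (2 * n + 1) : ℤ) : ℝ) * θ - (P (2 * n + 1) : ℤ) = cfErr θ (2 * n + 1) := by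
      push_cast; linarith
    have e2 : (((P (2 * n) : ℤ) + ((b : ℤ) - 1) * P (2 * n + 1) : ℤ) : ℝ)
        - ((Q (2 * n) : ℤ) + ((b : ℤ) - 1) * Q (2 * n + 1) : ℤ) * θ
        = cfErr θ (2 * n) - ((b : ℝ) - 1) * cfErr θ (2 * n + 1) := by
      push_cast; linear_combination -h0 - ((b : ℝ) - 1) * h1
    have hNz : (N : ℤ) + 2 = Q (2 * n) + (b + 1) * Q (2 * n + 1) := by exact_mod_cast hN
    rw [← e2]
    have hbQ : (0 : ℤ) ≤ b * Q (2 * n + 1) := by positivity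
    refine mem_gapSet_of_unimodular (q := Q (2 * n + 1)) (p := P (2 * n + 1))
      (by linear_combination hdet) (by rw [e1]; exact hE1) (by rw [e1, e2]; nlinarith)
      (by exact_mod_cast hQ1) (by linarith [(by exact_mod_cast hQ0 : (1 : ℤ) ≤ Q (2 * n))])
      (by rw [hNz]; ring)
  · rcases hB.eq_or_lt with rfl | hB2
    · have hrec := cfErr_rec hθ h01 (2 * n - 1)
      have hden : cfDen (cfQuot θ) (2 * n - 1 + 2) = cfQuot θ (2 * n - 1) *
        cfDen (cfQuot θ) (2 * n - 1 + 1) + cfDen (cfQuot θ) (2 * n - 1) := rfl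
      have hle := gap_le_cfErr_sub hθ h01 (k := 2 * n - 1) (N := N) le_rfl (ha _) (d := d)
      rw [hq, if_neg (by omega)] at hrec hden
      rw [show 2 * n - 1 + 1 = 2 * n by omega] at hrec hden hle
      rw [show 2 * n - 1 + 2 = 2 * n + 1 by omega] at hrec hden
      norm_num at hN
      have := hle (by omega) hd
      norm_num at this hrec ⊢
      linarith
    · have hle := gap_le_cfErr_sub hθ h01 (k := 2 * n) (N := N) (r := B / 2) (by omega)
        (by rw [hq, if_pos (by omega)]; omega) (d := d)
      exact hle (by rw [add_one_mul] at hN; omega) hd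

lemma cfDen_odd_sub (a : ℕ → ℕ) (ha : ∀ k, a k = if k % 2 = 0 then B else 1)
    (hξ : ξ ^ 2 + B * ξ = B) (n : ℕ) :
    ξ * cfDen a (2 * n + 1) - cfDen a (2 * n) = ξ * (1 - ξ) ^ n := by
  induction n with
  | zero => simp [cfDen]
  | succ n ih =>
    have h1 : cfDen a (2 * n + 2) = B * cfDen a (2 * n + 1) + cfDen a (2 * n) := by
      rw [cfDen, ha, if_pos (by omega)]
    have h2 : cfDen a (2 * (n + 1) + 1) = cfDen a (2 * n + 2) + cfDen a (2 * n + 1) := by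
      rw [show 2 * (n + 1) + 1 = 2 * n + 1 + 2 by ring, cfDen, ha, if_neg (by omega), one_mul]
    rw [h2, show 2 * (n + 1) = 2 * n + 2 by ring, h1, pow_succ]
    push_cast
    linear_combination (1 - ξ) * ih + (cfDen a (2 * n + 1) : ℝ) * hξ

lemma tendsto_extremalValue (hθ : Irrational θ) (h01 : θ ∈ Set.Ioo (0 : ℝ) 1) (hB : 1 ≤ B)
    (hq : ∀ k, cfQuot θ k = if k % 2 = 0 then B else 1) (hξ0 : 0 < ξ)
    (hξ : ξ ^ 2 + B * ξ = B) {Nseq : ℕ → ℕ}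
    (hN : ∀ n, 1 ≤ n → Nseq n + 2
      = cfDen (cfQuot θ) (2 * n) + (B / 2 + 1) * cfDen (cfQuot θ) (2 * n + 1))
    (hgap : ∀ n, 1 ≤ n → maxGap θ (Nseq n)
      = cfErr θ (2 * n) - (((B / 2 : ℕ) : ℝ) - 1) * cfErr θ (2 * n + 1)) :
    Filter.Tendsto (fun n => (Nseq n : ℝ) * maxGap θ (Nseq n)) Filter.atTop
      (nhds (extremalValue B ξ)) := by
  have ha := one_le_cfQuot hθ h01
  have hξ1 := lt_one_of_sq_add hξ0 hξ
  have hle : ∀ k, cfQuot θ k ≤ B := fun k => by rw [hq]; split_ifs <;> omega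
  set Q := cfDen (cfQuot θ) with hQ
  have hQpos : ∀ n, (0 : ℝ) < Q (2 * n + 1) := fun n => by exact_mod_cast cfDen_succ_pos ha _
  have hQinv : Filter.Tendsto (fun n => ((Q (2 * n + 1) : ℝ))⁻¹) Filter.atTop (nhds 0) := by
    refine Filter.Tendsto.inv_tendsto_atTop (tendsto_natCast_atTop_atTop.comp ?_)
    refine Filter.tendsto_atTop_mono (fun n => ?_) Filter.tendsto_id
    have : 2 * n ≤ Q (2 * n + 1) := le_cfDen_succ ha (2 * n)
    simp only [id]; omega
  have hpow : Filter.Tendsto (fun n => ξ * (1 - ξ) ^ n) Filter.atTop (nhds 0) := by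
    simpa using (tendsto_pow_atTop_nhds_zero_of_lt_one (by linarith : 0 ≤ 1 - ξ)
      (by linarith)).const_mul ξ
  set m := ((B / 2 + 1 : ℕ) : ℝ) with hm
  have hlim : Filter.Tendsto (fun n =>
      (m + ξ - (ξ * (1 - ξ) ^ n + 2) * (Q (2 * n + 1) : ℝ)⁻¹) * (B + 2 - m + ξ) /
        (B + 2 * ξ - ξ * (1 - ξ) ^ n * (Q (2 * n + 1) : ℝ)⁻¹)) Filter.atTop
      (nhds (extremalValue B ξ)) := by
    have h := (((tendsto_const_nhds (x := m + ξ)).sub ((hpow.add_const 2).mul hQinv)).mul_const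
      (B + 2 - m + ξ)).div ((tendsto_const_nhds (x := (B : ℝ) + 2 * ξ)).sub (hpow.mul hQinv))
      (by rw [mul_zero, sub_zero]; positivity)
    simp only [zero_add, mul_zero, sub_zero] at h
    exact h
  refine hlim.congr' ?_
  filter_upwards [Filter.eventually_ge_atTop 1] with n hn
  have htail : cfTail θ (2 * n + 1) = ξ :=
    le_antisymm (cfTail_le hθ h01 hle hξ0 hξ _) (le_cfTail_odd hθ h01 hq hξ0 hξ n)
  have hrec : cfErr θ (2 * n) = (B + ξ) * cfErr θ (2 * n + 1) := by
    rw [cfErr_rec hθ h01, show cfErr θ (2 * n + 2)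
      = cfTail θ (2 * n + 1) * cfErr θ (2 * n + 1) from rfl, htail, hq, if_pos (by omega)]
    ring
  have hone := cfDen_mul_cfErr_add hθ h01 (2 * n)
  have hdiff := cfDen_odd_sub (cfQuot θ) hq hξ n
  have hN' : (Nseq n : ℝ) + 2 = Q (2 * n) + m * Q (2 * n + 1) := by
    rw [hm]; exact_mod_cast hN n hn
  have hb : ((B / 2 : ℕ) : ℝ) = m - 1 := by rw [hm, Nat.cast_add_one]; ring
  rw [hgap n hn, hb, hrec]
  rw [hrec] at hone
  rw [← hQ] at hone hdiff
  have hpos := hQpos n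
  have hden : B + 2 * ξ - ξ * (1 - ξ) ^ n * (Q (2 * n + 1) : ℝ)⁻¹
      = (Q (2 * n + 1) * (B + ξ) + Q (2 * n)) * (Q (2 * n + 1) : ℝ)⁻¹ := by
    rw [← hdiff]; field_simp; ring
  have hdpos : 0 < (Q (2 * n + 1) * (B + ξ) + Q (2 * n)) * (Q (2 * n + 1) : ℝ)⁻¹ := by
    positivity
  have hnum : m + ξ - (ξ * (1 - ξ) ^ n + 2) * (Q (2 * n + 1) : ℝ)⁻¹
      = Nseq n * (Q (2 * n + 1) : ℝ)⁻¹ := by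
    rw [← hdiff, eq_sub_of_add_eq hN']; field_simp; ring
  rw [hden, hnum, div_eq_iff hdpos.ne']
  linear_combination -(Nseq n : ℝ) * (Q (2 * n + 1) : ℝ)⁻¹ * (B + 2 - m + ξ) * hone

end Periodic

/-- **Corollary (maximal gaps).**  Let `θ = [0; B, 1, B, 1, …]` with convergents `p_n/q_n`.
For `N_n = q_{2n-1} + ⌊(B+2)/2⌋·q_{2n} - 2` the largest gap is
`H(θ, N_n) = ‖q_{2n-1}θ‖ - ⌊(B-2)/2⌋·‖q_{2n}θ‖`, and `N_n·H(θ, N_n) → f(B)` as `n → ∞`. -/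
theorem maximal_gap_sequence (B : ℕ) (hB : 1 ≤ B) (θ : ℝ) (hθ : Irrational θ)
    (hh : (GenContFract.of θ).h = 0)
    (hcf : ∀ i : ℕ,
      (GenContFract.of θ).partDens.get? i = some (if i % 2 = 0 then (B : ℝ) else 1))
    (Nseq : ℕ → ℕ)
    (hNseq : ∀ n : ℕ, 1 ≤ n →
      (Nseq n : ℝ) = (GenContFract.of θ).dens (2 * n - 1) +
        (⌊((B : ℝ) + 2) / 2⌋ : ℝ) * (GenContFract.of θ).dens (2 * n) - 2) :
    (∀ n : ℕ, 1 ≤ n →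
      maxGap θ (Nseq n) =
        distNearestInt ((GenContFract.of θ).dens (2 * n - 1) * θ) -
          (⌊((B : ℝ) - 2) / 2⌋ : ℝ) * distNearestInt ((GenContFract.of θ).dens (2 * n) * θ)) ∧
    Filter.Tendsto (fun n : ℕ => (Nseq n : ℝ) * maxGap θ (Nseq n))
      Filter.atTop (nhds (badF B)) := by
  obtain ⟨hθ0, hθ1⟩ : 0 ≤ θ ∧ θ < 1 := by
    have h : ⌊θ⌋ = 0 := by
      rw [GenContFract.of_h_eq_floor] at hh; exact_mod_cast hh
    simpa using Int.floor_eq_iff.1 h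
  have h01 : θ ∈ Set.Ioo (0 : ℝ) 1 := ⟨lt_of_le_of_ne hθ0 hθ.ne_zero.symm, hθ1⟩
  have hq : ∀ k, cfQuot θ k = if k % 2 = 0 then B else 1 := fun k => by
    have h := hcf k
    rw [partDens_get?_eq hθ h01, Option.some_inj] at h
    exact_mod_cast h
  have hNadd : ∀ n, 1 ≤ n → Nseq n + 2
      = cfDen (cfQuot θ) (2 * n) + (B / 2 + 1) * cfDen (cfQuot θ) (2 * n + 1) := fun n hn => by
    have h := hNseq n hn
    rw [dens_eq_cfDen hθ h01, dens_eq_cfDen hθ h01, floor_add_two_half,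
      show 2 * n - 1 + 1 = 2 * n by omega] at h
    have h' : (Nseq n : ℝ) + 2 = cfDen (cfQuot θ) (2 * n) +
        ((B / 2 + 1 : ℕ) : ℝ) * cfDen (cfQuot θ) (2 * n + 1) := by
      rw [h, Int.cast_natCast]; ring
    exact_mod_cast h'
  have hgap := fun n hn => maxGap_eq hθ h01 hB hq hn (hNadd n hn)
  refine ⟨fun n hn => ?_, ?_⟩
  · obtain ⟨n, rfl⟩ := Nat.exists_eq_add_of_le' hn
    rw [hgap _ hn, floor_sub_two_half, show 2 * (n + 1) - 1 = 2 * n + 1 - 1 + 1 by omega,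
      distNearestInt_dens hθ h01, show 2 * (n + 1) = 2 * n + 1 + 1 by omega,
      distNearestInt_dens hθ h01, Nat.add_sub_cancel]
    push_cast
    rfl
  · obtain ⟨ξ, hξ0, hξ⟩ := exists_pos_sq_add B hB
    have hle : ∀ k, cfQuot θ k ≤ B := fun k => by rw [hq]; split_ifs <;> omega
    have hlim := tendsto_extremalValue hθ h01 hB hq hξ0 hξ hNadd hgap
    have hub : ∀ x ∈ {x : ℝ | ∃ θ ∈ SB B, ∃ N : ℕ, 1 ≤ N ∧ x = (N : ℝ) * maxGap θ N},
        x ≤ extremalValue B ξ := by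
      rintro _ ⟨φ, ⟨hφ, hφ01, hφB⟩, N, -, rfl⟩
      refine mul_maxGap_le hB hφ hφ01 (fun k => ?_) hξ0 hξ N
      exact_mod_cast hφB k _ (partDens_get?_eq hφ hφ01 k)
    have hSB : θ ∈ SB B := by
      refine ⟨hθ, h01, fun i a ha => ?_⟩
      rw [partDens_get?_eq hθ h01, Option.mem_some_iff] at ha
      rw [← ha]
      exact_mod_cast hle i
    have hval : badF B = extremalValue B ξ := by
      refine le_antisymm (Real.sSup_le hub (extremalValue_pos hξ0).le) ?_
      refine le_of_tendsto hlim ?_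
      filter_upwards [Filter.eventually_ge_atTop 1] with n hn
      refine le_csSup ⟨_, hub⟩ ⟨θ, hSB, Nseq n, ?_, rfl⟩
      have ha := one_le_cfQuot hθ h01
      have h1 := hNadd n hn
      have h2 := le_cfDen_succ ha (2 * n)
      have h3 := cfDen_succ_pos ha (2 * n - 1)
      rw [show 2 * n - 1 + 1 = 2 * n by omega] at h3
      have h4 := Nat.le_mul_of_pos_left (cfDen (cfQuot θ) (2 * n + 1)) (Nat.succ_pos (B / 2))
      rw [Nat.succ_eq_add_one] at h4
      omega
    rwa [hval]
end

section
/- Let θ be an irrational real number with 0 < θ < 1 whose continued fraction partial quotients are bounded by B, and let β be a real number with 0 ≤ β < 1. Then for every positive integer N there exist integers n, p with 0 ≤ n ≤ N and |p| ≤ N such that |nθ − p − β| ≤ f(B)/(2N). -/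
/-- The continuants of the continued fraction of a real number are integers. -/
theorem exists_int_contsAux_eq (θ : ℝ) (n : ℕ) :
    ∃ p q : ℤ, (GenContFract.of θ).contsAux n = ⟨(p : ℝ), (q : ℝ)⟩ := by
  induction n using Nat.strong_induction_on with
  | _ n ih =>
    match n, ih with
    | 0, _ => exact ⟨1, 0, by simp⟩
    | 1, _ => exact ⟨⌊θ⌋, 1, by simp [GenContFract.of_h_eq_floor]⟩
    | n + 2, ih =>
      obtain ⟨p, q, h⟩ := ih n (by lia)
      obtain ⟨p', q', h'⟩ := ih (n + 1) (by lia)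
      rcases hs : (GenContFract.of θ).s.get? n with _ | gp
      · refine ⟨p', q', ?_⟩
        rw [GenContFract.contsAux_stable_step_of_terminated hs, h']
      · obtain ⟨ha, z, hz⟩ := GenContFract.of_partNum_eq_one_and_exists_int_partDen_eq hs
        refine ⟨z * p' + p, z * q' + q, ?_⟩
        rw [GenContFract.contsAux_recurrence hs h h', ha, hz]
        push_cast
        simp

theorem Irrational.not_terminatedAt {θ : ℝ} (hθ : Irrational θ) (n : ℕ) :
    ¬ (GenContFract.of θ).TerminatedAt n := by
  intro h
  obtain ⟨q, hq⟩ := (GenContFract.terminates_iff_rat θ).1 ⟨n, h⟩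
  exact hθ ⟨q, hq.symm⟩

theorem PartQuotBounded.dens_succ_le {θ : ℝ} {B : ℕ} (hθ : Irrational θ)
    (hB : PartQuotBounded θ B) (n : ℕ) :
    (GenContFract.of θ).dens (n + 1) ≤ (B + 1) * (GenContFract.of θ).dens n := by
  obtain ⟨gp, hs⟩ := Option.ne_none_iff_exists'.1 (hθ.not_terminatedAt n)
  have hb : gp.b ≤ B := hB n gp.b (GenContFract.partDen_eq_s_b hs)
  have ha : gp.a = 1 := (GenContFract.of_partNum_eq_one_and_exists_int_partDen_eq hs).1
  have hmono : ((GenContFract.of θ).contsAux n).b ≤ ((GenContFract.of θ).contsAux (n + 1)).b := by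
    cases n with
    | zero => simp
    | succ k => exact GenContFract.of_den_mono
  have hpos : 0 ≤ ((GenContFract.of θ).contsAux (n + 1)).b := GenContFract.zero_le_of_contsAux_b
  change ((GenContFract.of θ).contsAux (n + 2)).b ≤
    (B + 1) * ((GenContFract.of θ).contsAux (n + 1)).b
  rw [GenContFract.contsAux_recurrence hs rfl rfl, ha]
  nlinarith

/-- A real number with partial quotients bounded by `B` has a good rational approximation with
denominator in `(N / (B + 1), N]`. -/
theorem PartQuotBounded.exists_isCoprime_approx {θ : ℝ} {B : ℕ} (hθ : Irrational θ)
    (hB : PartQuotBounded θ B) {N : ℕ} (hN : 1 ≤ N) :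
    ∃ p q : ℤ, IsCoprime p q ∧ 1 ≤ q ∧ q ≤ N ∧ (N : ℝ) ≤ (B + 1) * q ∧
      |q * θ - p| ≤ 1 / q := by
  have hfib (n : ℕ) : (Nat.fib (n + 1) : ℝ) ≤ (GenContFract.of θ).dens n :=
    GenContFract.succ_nth_fib_le_of_nth_den (Or.inr (hθ.not_terminatedAt _))
  have hex : ∃ n, (N : ℝ) < (GenContFract.of θ).dens n := by
    refine ⟨N + 1, lt_of_lt_of_le ?_ (hfib _)⟩
    have := Nat.le_fib_add_one (N + 2)
    exact_mod_cast (by lia : N < Nat.fib (N + 1 + 1))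
  classical
  obtain ⟨k, hk⟩ : ∃ k, Nat.find hex = k + 1 := by
    refine Nat.exists_eq_succ_of_ne_zero fun h0 => ?_
    have := Nat.find_spec hex
    rw [h0, GenContFract.zeroth_den_eq_one] at this
    have : N < 1 := by exact_mod_cast this
    lia
  have hlt : (N : ℝ) < (GenContFract.of θ).dens (k + 1) := hk ▸ Nat.find_spec hex
  have hle : (GenContFract.of θ).dens k ≤ N := not_lt.1 (Nat.find_min hex (by lia))
  obtain ⟨p, q, h⟩ := exists_int_contsAux_eq θ (k + 1)
  obtain ⟨p', q', h'⟩ := exists_int_contsAux_eq θ (k + 2)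
  have hp : (GenContFract.of θ).nums k = p := congrArg GenContFract.Pair.a h
  have hq : (GenContFract.of θ).dens k = q := congrArg GenContFract.Pair.b h
  have hp' : (GenContFract.of θ).nums (k + 1) = p' := congrArg GenContFract.Pair.a h'
  have hq' : (GenContFract.of θ).dens (k + 1) = q' := congrArg GenContFract.Pair.b h'
  have hdet := SimpContFract.determinant (s := SimpContFract.of θ) (hθ.not_terminatedAt k)
  change (GenContFract.of θ).nums k * (GenContFract.of θ).dens (k + 1) -
    (GenContFract.of θ).dens k * (GenContFract.of θ).nums (k + 1) = _ at hdet
  rw [hp, hq, hp', hq'] at hdet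
  have hdetZ : p * q' - q * p' = (-1) ^ (k + 1) := by exact_mod_cast hdet
  have hq1 : 1 ≤ q := by
    have h1 := hfib k
    rw [hq] at h1
    have h2 : 1 ≤ Nat.fib (k + 1) := Nat.fib_pos.2 (by lia)
    have h3 : (Nat.fib (k + 1) : ℤ) ≤ q := by exact_mod_cast h1
    lia
  have hq0 : (0 : ℝ) < q := by exact_mod_cast hq1
  have hmono : (q : ℝ) ≤ q' := by
    rw [← hq, ← hq']
    exact GenContFract.of_den_mono
  refine ⟨p, q, ?_, hq1, by rw [hq] at hle; exact_mod_cast hle, ?_, ?_⟩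
  · refine ⟨(-1) ^ (k + 1) * q', -((-1) ^ (k + 1) * p'), ?_⟩
    have hsq : ((-1 : ℤ) ^ (k + 1)) * (-1) ^ (k + 1) = 1 := by
      rw [← mul_pow]; simp
    linear_combination (-1) ^ (k + 1) * hdetZ + hsq
  · rw [← hq]
    exact hlt.le.trans (hB.dens_succ_le hθ k)
  · have happ := GenContFract.abs_sub_convs_le (hθ.not_terminatedAt k)
    rw [GenContFract.conv_eq_num_div_den, hp, hq, hq'] at happ
    have heq : (q : ℝ) * θ - p = q * (θ - p / q) := by field_simp
    rw [heq, abs_mul, abs_of_pos hq0]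
    calc (q : ℝ) * |θ - p / q| ≤ q * (1 / (q * q')) := by gcongr
      _ = 1 / q' := by field_simp
      _ ≤ 1 / q := by gcongr

theorem gapPoints_subset_Icc (θ : ℝ) (N : ℕ) : gapPoints θ N ⊆ Set.Icc 0 1 := by
  rintro x (rfl | ⟨k, -, rfl⟩)
  · simp
  · exact ⟨Int.fract_nonneg _, (Int.fract_lt_one _).le⟩

theorem gapPoints_finite (θ : ℝ) (N : ℕ) : (gapPoints θ N).Finite := by
  refine Set.Finite.insert _ (((Set.finite_Iic N).image fun k : ℕ => Int.fract (k * θ)).subset ?_)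
  rintro x ⟨k, hk, rfl⟩
  exact ⟨k, hk, rfl⟩

/-- A rational approximation `p / q` of `θ` with `q ≤ N` and `|q θ - p| ≤ 1 / q` bounds the gaps of
`0, {θ}, …, {Nθ}, 1`. -/
theorem gap_le_of_approx {θ : ℝ} {N : ℕ} {p q : ℤ} (hpq : IsCoprime p q) (hq1 : 1 ≤ q)
    (hqN : q ≤ N) (happ : |q * θ - p| ≤ 1 / q) {d : ℝ} (hd : d ∈ gapSet θ N) : d ≤ 3 / q := by
  obtain ⟨a, ha, b, hb, -, hc, rfl⟩ := hd
  by_contra! hlt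
  have hq0 : (0 : ℝ) < q := by exact_mod_cast hq1
  rw [div_lt_iff₀ hq0] at hlt
  set m : ℤ := ⌊q * a⌋ + 2 with hm
  have hm1 : (q : ℝ) * a + 1 < m := by
    have := Int.lt_floor_add_one (q * a)
    push_cast [hm]; linarith
  have hm2 : (m : ℝ) + 1 < q * b := by
    have := Int.floor_le (q * a)
    push_cast [hm]; linarith
  obtain ⟨u, v, huv⟩ := hpq
  obtain ⟨t, ht⟩ : ∃ t : ℤ, (m * u) % q * p = m + q * t := by
    refine ⟨-(m * v) - (m * u) / q * p, ?_⟩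
    linear_combination p * Int.emod_add_mul_ediv (m * u) q + m * huv
  have hj0 : 0 ≤ (m * u) % q := Int.emod_nonneg _ (by lia)
  have hjq : (m * u) % q < q := Int.emod_lt_of_pos _ (by lia)
  obtain ⟨j, hj⟩ := Int.eq_ofNat_of_zero_le hj0
  rw [hj] at ht hjq
  have htR : (j : ℝ) * p = m + q * t := by exact_mod_cast ht
  have hjR : (j : ℝ) ≤ q := by exact_mod_cast hjq.le
  have hdist : |q * (j * θ - t) - m| ≤ 1 := by
    have heq : q * (j * θ - t) - m = j * (q * θ - p) := by linear_combination htR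
    rw [heq, abs_mul, Nat.abs_cast]
    calc (j : ℝ) * |q * θ - p| ≤ q * (1 / q) := by gcongr
      _ = 1 := by field_simp
  rw [abs_le] at hdist
  have hxa : a < j * θ - t := lt_of_mul_lt_mul_left (by linarith) hq0.le
  have hxb : j * θ - t < b := lt_of_mul_lt_mul_left (by linarith) hq0.le
  have hfract : j * θ - t = Int.fract (j * θ) := by
    refine (Int.fract_eq_iff.2 ⟨?_, ?_, t, by ring⟩).symm
    · linarith [(gapPoints_subset_Icc θ N ha).1]
    · linarith [(gapPoints_subset_Icc θ N hb).2]
  exact hc _ (Or.inr ⟨j, by lia, hfract⟩) ⟨hxa, hxb⟩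

theorem bddAbove_gapSet (θ : ℝ) (N : ℕ) : BddAbove (gapSet θ N) := by
  refine ⟨1, ?_⟩
  rintro d ⟨a, ha, b, hb, -, -, rfl⟩
  linarith [(gapPoints_subset_Icc θ N ha).1, (gapPoints_subset_Icc θ N hb).2]

theorem bddAbove_mul_maxGap (B : ℕ) :
    BddAbove {x : ℝ | ∃ θ ∈ SB B, ∃ N : ℕ, 1 ≤ N ∧ x = (N : ℝ) * maxGap θ N} := by
  refine ⟨3 * (B + 1), ?_⟩
  rintro x ⟨θ, ⟨hθ, -, hB⟩, N, hN, rfl⟩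
  obtain ⟨p, q, hpq, hq1, hqN, hNq, happ⟩ := hB.exists_isCoprime_approx hθ hN
  have hq0 : (0 : ℝ) < q := by exact_mod_cast hq1
  have hgap : maxGap θ N ≤ 3 / q :=
    Real.sSup_le (fun d hd => gap_le_of_approx hpq hq1 hqN happ hd) (by positivity)
  calc (N : ℝ) * maxGap θ N ≤ N * (3 / q) := by gcongr
    _ ≤ (B + 1) * q * (3 / q) := by gcongr
    _ = 3 * (B + 1) := by field_simp

/-- Every `β ∈ [0, 1)` lies between two consecutive points among `0, {θ}, …, {Nθ}, 1`. -/
theorem exists_consecutive_gapPoints (θ : ℝ) (N : ℕ) {β : ℝ} (hβ0 : 0 ≤ β) (hβ1 : β < 1) :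
    ∃ a ∈ gapPoints θ N, ∃ b ∈ gapPoints θ N, a ≤ β ∧ β < b ∧ b - a ∈ gapSet θ N := by
  have hfin := gapPoints_finite θ N
  obtain ⟨a, ⟨haS, ha⟩, hamax⟩ :=
    (hfin.inter_of_left (Set.Iic β)).exists_maximal ⟨0, Or.inr ⟨0, by simp, by simp⟩, hβ0⟩
  obtain ⟨b, ⟨hbS, hb⟩, hbmin⟩ :=
    (hfin.inter_of_left (Set.Ioi β)).exists_minimal ⟨1, Or.inl rfl, hβ1⟩
  refine ⟨a, haS, b, hbS, ha, hb, a, haS, b, hbS, lt_of_le_of_lt ha hb, ?_, rfl⟩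
  rintro c hcS ⟨hac, hcb⟩
  rcases le_or_gt c β with h | h
  · exact absurd (hamax ⟨hcS, h⟩ hac.le) (not_le.2 hac)
  · exact absurd (hbmin ⟨hcS, h⟩ hcb.le) (not_le.2 hcb)

/-- Points of `0, {θ}, …, {Nθ}, 1` have the form `n θ - p` with `0 ≤ n ≤ N` and `|p| ≤ N`. -/
theorem exists_eq_of_mem_gapPoints {θ : ℝ} (hθ0 : 0 < θ) (hθ1 : θ < 1) {N : ℕ} (hN : 1 ≤ N)
    {x : ℝ} (hx : x ∈ gapPoints θ N) :
    ∃ n p : ℤ, 0 ≤ n ∧ n ≤ (N : ℤ) ∧ |p| ≤ (N : ℤ) ∧ (n : ℝ) * θ - p = x := by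
  rcases hx with rfl | ⟨k, hk, rfl⟩
  · exact ⟨0, -1, le_rfl, by lia, by simpa using hN, by simp⟩
  · have h0 : 0 ≤ ⌊(k : ℝ) * θ⌋ := Int.floor_nonneg.2 (by positivity)
    have h1 : (⌊(k : ℝ) * θ⌋ : ℝ) ≤ k :=
      (Int.floor_le _).trans (mul_le_of_le_one_right (by positivity) hθ1.le)
    have h2 : ⌊(k : ℝ) * θ⌋ ≤ k := by exact_mod_cast h1
    refine ⟨k, ⌊(k : ℝ) * θ⌋, by lia, by lia, ?_, by simp⟩
    rw [abs_of_nonneg h0]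
    lia

/-- **Theorem 6 (Kronecker's theorem for badly approximable numbers).**  If `θ ∈ (0,1)` is
irrational with partial quotients bounded by `B` and `0 ≤ β < 1`, then for every `N ≥ 1`
there are integers `n, p` with `0 ≤ n ≤ N` and `|p| ≤ N` such that
`|nθ - p - β| ≤ f(B)/(2N)`. -/
theorem kronecker_badly_approximable (θ : ℝ) (hθ : Irrational θ)
    (hθ0 : 0 < θ) (hθ1 : θ < 1) (B : ℕ) (hB : PartQuotBounded θ B)
    (β : ℝ) (hβ0 : 0 ≤ β) (hβ1 : β < 1) (N : ℕ) (hN : 1 ≤ N) :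
    ∃ n p : ℤ, 0 ≤ n ∧ n ≤ (N : ℤ) ∧ |p| ≤ (N : ℤ) ∧
      |(n : ℝ) * θ - (p : ℝ) - β| ≤ badF B / (2 * (N : ℝ)) := by
  have hN0 : (0 : ℝ) < N := by exact_mod_cast hN
  have hmax : (N : ℝ) * maxGap θ N ≤ badF B :=
    le_csSup (bddAbove_mul_maxGap B) ⟨θ, ⟨hθ, ⟨hθ0, hθ1⟩, hB⟩, N, hN, rfl⟩
  obtain ⟨a, ha, b, hb, haβ, hβb, hab⟩ := exists_consecutive_gapPoints θ N hβ0 hβ1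
  have hgap : b - a ≤ badF B / N := by
    rw [le_div_iff₀' hN0]
    refine le_trans ?_ hmax
    gcongr
    exact le_csSup (bddAbove_gapSet θ N) hab
  have hhalf : badF B / (2 * (N : ℝ)) = badF B / N / 2 := by field_simp
  have hnear : ∃ x ∈ gapPoints θ N, |x - β| ≤ badF B / (2 * (N : ℝ)) := by
    rw [hhalf]
    rcases le_total (β - a) (b - β) with h | h
    · exact ⟨a, ha, by rw [abs_le]; constructor <;> linarith⟩
    · exact ⟨b, hb, by rw [abs_le]; constructor <;> linarith⟩
  obtain ⟨x, hx, hxβ⟩ := hnear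
  obtain ⟨n, p, hn0, hnN, hpN, rfl⟩ := exists_eq_of_mem_gapPoints hθ0 hθ1 hN hx
  exact ⟨n, p, hn0, hnN, hpN, hxβ⟩
end
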